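/- The W-orbit of ϖ₆ = (0, 0, 0, 0, 0, 2/√3) in ℂ^6 has exactly 27 elements. -/

import Mathlib

open scoped Classical

/-- The standard symmetric bilinear form on `ℂ^6`. -/
noncomputable def B6 (x y : Fin 6 → ℂ) : ℂ := ∑ i, x i * y i

/-- The root system of type `E₆` in the coordinates of the paper:
`±e_i ± e_j` for `1 ≤ i < j ≤ 5` (zero-based: `i < j`, `(j : ℕ) < 5`), together with
`(ε₁/2, …, ε₅/2, ε·√3/2)` with `ε₁, …, ε₅, ε ∈ {1, -1}` and an odd number of `+1`'s. -/
noncomputable def PhiE6 : Set (Fin 6 → ℂ) :=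
  {α | (∃ (i j : Fin 6) (s t : ℂ), (i : ℕ) < (j : ℕ) ∧ (j : ℕ) < 5 ∧
        (s = 1 ∨ s = -1) ∧ (t = 1 ∨ t = -1) ∧
        α = fun k => (if k = i then s else 0) + (if k = j then t else 0)) ∨
      (∃ ε : Fin 6 → ℂ, (∀ k, ε k = 1 ∨ ε k = -1) ∧
        Odd (Finset.univ.filter fun k : Fin 6 => ε k = 1).card ∧
        α = fun k : Fin 6 => if (k : ℕ) = 5 then ε k * ((Real.sqrt 3 / 2 : ℝ) : ℂ)
          else ε k / 2)}

/-- The minuscule fundamental weight `ϖ₆ = (0, 0, 0, 0, 0, 2/√3)`. -/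
noncomputable def varpiE6 : Fin 6 → ℂ :=
  fun k => if (k : ℕ) = 5 then ((2 / Real.sqrt 3 : ℝ) : ℂ) else 0

/-- The Weyl group of `E₆`: the subgroup of linear automorphisms of `ℂ^6` generated by
the reflections `s_α : x ↦ x - B(x, α)·α` for `α ∈ Φ` (all roots have `B(α,α) = 2`). -/
noncomputable def WE6 : Subgroup ((Fin 6 → ℂ) ≃ₗ[ℂ] (Fin 6 → ℂ)) :=
  Subgroup.closure
    {w : (Fin 6 → ℂ) ≃ₗ[ℂ] (Fin 6 → ℂ) | ∃ α ∈ PhiE6, ∀ x, w x = x - B6 x α • α}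

/-- The vector `(n₀/2, …, n₄/2, n₅/(2√3))` with integral coordinates `n`. -/
noncomputable def ofIntCoords (n : Fin 6 → ℤ) : Fin 6 → ℂ :=
  fun k => if (k : ℕ) = 5 then (n k : ℂ) / (2 * ((Real.sqrt 3 : ℝ) : ℂ)) else (n k : ℂ) / 2

/-- Twelve times the bilinear form `B6`, in integral coordinates. -/
def intForm (x y : Fin 6 → ℤ) : ℤ :=
  3 * (x 0 * y 0 + x 1 * y 1 + x 2 * y 2 + x 3 * y 3 + x 4 * y 4) + x 5 * y 5

/-- Membership in the weight lattice of `E₆`, in integral coordinates. -/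
def IsLatticeVec (x : Fin 6 → ℤ) : Prop :=
  (∀ k, x k % 2 = x 5 % 2) ∧ (x 0 + x 1 + x 2 + x 3 + x 4) % 4 = x 5 % 4

/-- The roots of `E₆`, in integral coordinates. -/
def IsIntRoot (a : Fin 6 → ℤ) : Prop :=
  intForm a a = 24 ∧ IsLatticeVec a ∧ a 5 % 3 = 0

/-- The weights of the 27-dimensional representation, in integral coordinates. -/
def IsIntWeight (n : Fin 6 → ℤ) : Prop :=
  intForm n n = 16 ∧ IsLatticeVec n ∧ n 5 % 3 = 1

instance : DecidablePred IsIntWeight := fun n =>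
  inferInstanceAs (Decidable (intForm n n = 16 ∧
    ((∀ k, n k % 2 = n 5 % 2) ∧ (n 0 + n 1 + n 2 + n 3 + n 4) % 4 = n 5 % 4) ∧ n 5 % 3 = 1))

lemma ofReal_sqrt_three_sq : ((Real.sqrt 3 : ℝ) : ℂ) ^ 2 = 3 := by
  rw [← Complex.ofReal_pow, Real.sq_sqrt (by norm_num)]
  norm_num

lemma ofReal_sqrt_three_ne_zero : ((Real.sqrt 3 : ℝ) : ℂ) ≠ 0 := by
  intro h
  have := ofReal_sqrt_three_sq
  rw [h] at this
  norm_num at this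

lemma ofIntCoords_injective : Function.Injective ofIntCoords := by
  intro x y h
  funext k
  have hk := congrFun h k
  have h0 := ofReal_sqrt_three_ne_zero
  unfold ofIntCoords at hk
  split_ifs at hk
  · field_simp at hk
    exact_mod_cast hk
  · field_simp at hk
    exact_mod_cast hk

lemma B6_ofIntCoords (x y : Fin 6 → ℤ) :
    B6 (ofIntCoords x) (ofIntCoords y) = (intForm x y : ℂ) / 12 := by
  have h0 := ofReal_sqrt_three_ne_zero
  have h3 := ofReal_sqrt_three_sq
  simp only [B6, Fin.sum_univ_six, ofIntCoords, intForm]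
  norm_num
  field_simp
  rw [h3]
  ring

lemma ofIntCoords_sub_smul (n a : Fin 6 → ℤ) (c : ℤ) :
    ofIntCoords n - (c : ℂ) • ofIntCoords a = ofIntCoords (fun k => n k - c * a k) := by
  funext k
  simp only [ofIntCoords, Pi.sub_apply, Pi.smul_apply, smul_eq_mul]
  split_ifs <;> push_cast <;> ring

lemma IsLatticeVec.twelve_dvd_intForm {n a : Fin 6 → ℤ} (hn : IsLatticeVec n)
    (ha : IsLatticeVec a) (ha3 : a 5 % 3 = 0) : (12 : ℤ) ∣ intForm n a := by
  have key : ∀ x : Fin 6 → ℤ, IsLatticeVec x → ∃ u : Fin 5 → ℤ, ∃ t : ℤ,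
      x 0 = x 5 + 2 * u 0 ∧ x 1 = x 5 + 2 * u 1 ∧ x 2 = x 5 + 2 * u 2 ∧ x 3 = x 5 + 2 * u 3 ∧
      x 4 = x 5 + 2 * u 4 ∧ u 4 = 2 * t - u 0 - u 1 - u 2 - u 3 := by
    intro x ⟨hx, hs⟩
    have h0 := hx 0
    have h1 := hx 1
    have h2 := hx 2
    have h3 := hx 3
    have h4 := hx 4
    refine ⟨![(x 0 - x 5) / 2, (x 1 - x 5) / 2, (x 2 - x 5) / 2, (x 3 - x 5) / 2,
      (x 4 - x 5) / 2], (x 0 + x 1 + x 2 + x 3 + x 4 - 5 * x 5) / 4, ?_⟩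
    simp only [Matrix.cons_val]
    omega
  obtain ⟨u, t, e0, e1, e2, e3, e4, eu⟩ := key n hn
  obtain ⟨v, r, f0, f1, f2, f3, f4, fv⟩ := key a ha
  obtain ⟨q, hq⟩ : (3 : ℤ) ∣ a 5 := by omega
  refine ⟨n 5 * 4 * q + n 5 * r + a 5 * t + (u 0 * v 0 + u 1 * v 1 + u 2 * v 2 + u 3 * v 3
    + u 4 * v 4), ?_⟩
  unfold intForm
  rw [e0, e1, e2, e3, e4, f0, f1, f2, f3, f4, eu, fv, hq]
  ring

lemma IsIntWeight.sub_mul {n a : Fin 6 → ℤ} (hn : IsIntWeight n) (ha : IsIntRoot a) {c : ℤ}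
    (hc : intForm n a = 12 * c) : IsIntWeight (fun k => n k - c * a k) := by
  obtain ⟨hn1, ⟨hn2, hn3⟩, hn4⟩ := hn
  obtain ⟨ha1, ⟨ha2, ha3⟩, ha4⟩ := ha
  refine ⟨?_, ⟨fun k => ?_, ?_⟩, ?_⟩
  · unfold intForm at *
    linear_combination hn1 - 2 * c * hc + c ^ 2 * ha1
  · exact Int.ModEq.sub (hn2 k) (Int.ModEq.mul_left c (ha2 k))
  · have h := Int.ModEq.sub hn3 (Int.ModEq.mul_left c ha3)
    unfold Int.ModEq at h
    rw [← h]
    ring_nf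
  · have h := Int.ModEq.sub (n := 3) (b := 1) hn4 (Int.ModEq.mul_left c (b := 0) ha4)
    simpa [Int.ModEq] using h

lemma odd_card_filter_eq_one_iff (e : Fin 6 → ℤ) (he : ∀ k, e k = 1 ∨ e k = -1) :
    Odd (Finset.univ.filter fun k : Fin 6 => e k = 1).card ↔ (4 : ℤ) ∣ ∑ k, e k := by
  have h : 2 * ((Finset.univ.filter fun k : Fin 6 => e k = 1).card : ℤ) = ∑ k, e k + 6 := by
    have h6 : (6 : ℤ) = ∑ _k : Fin 6, 1 := by simp
    rw [Finset.card_filter, h6, ← Finset.sum_add_distrib, Nat.cast_sum, Finset.mul_sum]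
    refine Finset.sum_congr rfl fun k _ => ?_
    rcases he k with h | h <;> simp [h]
  rw [Nat.odd_iff]
  omega

lemma exists_isIntRoot_of_mem_PhiE6 {α : Fin 6 → ℂ} (hα : α ∈ PhiE6) :
    ∃ a, IsIntRoot a ∧ ofIntCoords a = α := by
  rcases hα with ⟨i, j, s, t, hij, hj, hs, ht, rfl⟩ | ⟨ε, hε, hodd, rfl⟩
  · have key : ∀ z : ℂ, z = 1 ∨ z = -1 → ∃ m : ℤ, (m : ℂ) = z ∧ (m = 1 ∨ m = -1) := by
      rintro z (rfl | rfl)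
      · exact ⟨1, by simp⟩
      · exact ⟨-1, by simp⟩
    obtain ⟨s, rfl, hs'⟩ := key s hs
    obtain ⟨t, rfl, ht'⟩ := key t ht
    refine ⟨fun k => 2 * ((if k = i then s else 0) + (if k = j then t else 0)), ?_, ?_⟩
    · fin_cases i <;> fin_cases j <;> simp at hij hj <;>
        rcases hs' with rfl | rfl <;> rcases ht' with rfl | rfl <;>
        simp [IsIntRoot, IsLatticeVec, intForm]
    · funext k
      have hi5 : (i : ℕ) ≠ 5 := by omega
      by_cases hk : (k : ℕ) = 5
      · have h1 : k ≠ i := fun h => by subst h; omega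
        have h2 : k ≠ j := fun h => by subst h; omega
        simp [ofIntCoords, h1, h2]
      · simp only [ofIntCoords, hk, if_false]
        split_ifs <;> push_cast <;> ring
  · have key : ∀ k, ∃ m : ℤ, ε k = (m : ℂ) ∧ (m = 1 ∨ m = -1) := by
      intro k
      rcases hε k with h | h
      · exact ⟨1, by simp [h]⟩
      · exact ⟨-1, by simp [h]⟩
    choose e hεe he using key
    obtain rfl : ε = fun k => (e k : ℂ) := funext hεe
    have h4 : (4 : ℤ) ∣ ∑ k, e k := by
      rw [← odd_card_filter_eq_one_iff e he]
      convert hodd using 5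
      simp
    rw [Fin.sum_univ_six] at h4
    refine ⟨fun k => if (k : ℕ) = 5 then 3 * e k else e k, ⟨?_, ⟨fun k => ?_, ?_⟩, ?_⟩, ?_⟩
    · have hsq : ∀ k, e k * e k = 1 := fun k => by rcases he k with h | h <;> simp [h]
      simp only [intForm, Fin.isValue, Fin.coe_ofNat_eq_mod]
      norm_num
      linear_combination 3 * (hsq 0 + hsq 1 + hsq 2 + hsq 3 + hsq 4) + 9 * hsq 5
    · have h1 := he k
      have h2 := he 5
      simp only [Fin.isValue, Fin.coe_ofNat_eq_mod]
      split_ifs <;> omega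
    · simp only [Fin.isValue, Fin.coe_ofNat_eq_mod]
      norm_num
      omega
    · simp
    · funext k
      have h0 := ofReal_sqrt_three_ne_zero
      have h3 := ofReal_sqrt_three_sq
      simp only [ofIntCoords]
      split_ifs
      · push_cast
        field_simp
        rw [h3]
        ring
      · rfl

lemma IsIntRoot.ofIntCoords_mem_PhiE6 {a : Fin 6 → ℤ} (ha : IsIntRoot a) (h5 : a 5 = 3) :
    ofIntCoords a ∈ PhiE6 := by
  obtain ⟨h1, ⟨h2, h3⟩, -⟩ := ha
  have hsq : ∀ k, 1 ≤ a k * a k := fun k => by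
    have : a k ≠ 0 := fun h => by have := h2 k; omega
    have := mul_self_pos.mpr this
    omega
  have hle : ∀ k, k ≠ 5 → a k * a k ≤ 1 := by
    have := hsq 0
    have := hsq 1
    have := hsq 2
    have := hsq 3
    have := hsq 4
    simp only [intForm, h5] at h1
    intro k hk
    fin_cases k <;> simp at hk ⊢ <;> omega
  have hpm : ∀ k, k ≠ 5 → a k = 1 ∨ a k = -1 := fun k hk =>
    mul_self_eq_one_iff.mp (le_antisymm (hle k hk) (hsq k))
  let e : Fin 6 → ℤ := fun k => if k = 5 then 1 else a k
  have he : ∀ k, e k = 1 ∨ e k = -1 := by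
    intro k
    by_cases hk : k = 5
    · simp [e, hk]
    · simpa [e, hk] using hpm k hk
  refine Or.inr ⟨fun k => (e k : ℂ), fun k => ?_, ?_, ?_⟩
  · rcases he k with h | h <;> simp [h]
  · have h4 : (4 : ℤ) ∣ ∑ k, e k := by
      rw [Fin.sum_univ_six]
      simp [e]
      omega
    rw [← odd_card_filter_eq_one_iff e he] at h4
    convert h4 using 5
    simp
  · funext k
    have h0 := ofReal_sqrt_three_ne_zero
    have hs := ofReal_sqrt_three_sq
    by_cases hk : k = 5
    · subst hk
      simp [ofIntCoords, e, h5]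
      field_simp
      rw [hs]
    · have hk' : (k : ℕ) ≠ 5 := fun h => hk (Fin.ext h)
      simp [ofIntCoords, e, hk, hk']

lemma exists_mem_WE6_reflection {α : Fin 6 → ℂ} (hα : α ∈ PhiE6) (h2 : B6 α α = 2) :
    ∃ w ∈ WE6, ∀ x, w x = x - B6 x α • α := by
  let f : Module.Dual ℂ (Fin 6 → ℂ) :=
    { toFun := fun x => B6 x α
      map_add' := fun x y => by simp [B6, add_mul, Finset.sum_add_distrib]
      map_smul' := fun c x => by simp [B6, mul_assoc, Finset.mul_sum] }
  have hf : f α = 2 := h2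
  exact ⟨Module.reflection hf, Subgroup.subset_closure ⟨α, hα, fun x =>
    Module.reflection_apply x hf⟩, fun x => Module.reflection_apply x hf⟩

/-- Two weights with inner product `1/3` are exchanged by the reflection in their difference. -/
lemma exists_mem_WE6_apply_eq {m n : Fin 6 → ℤ} (hm : IsIntWeight m) (hn : IsIntWeight n)
    (hmn : intForm m n = 4) (h5 : m 5 - n 5 = 3) :
    ∃ w ∈ WE6, w (ofIntCoords m) = ofIntCoords n := by
  obtain ⟨hm1, ⟨hm2, hm3⟩, hm4⟩ := hm
  obtain ⟨hn1, ⟨hn2, hn3⟩, hn4⟩ := hn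
  have ha : IsIntRoot (fun k => m k - n k) := by
    refine ⟨?_, ⟨fun k => Int.ModEq.sub (hm2 k) (hn2 k), ?_⟩, ?_⟩
    · unfold intForm at *
      linear_combination hm1 + hn1 - 2 * hmn
    · dsimp only
      omega
    · dsimp only
      omega
  have h12 : intForm m (fun k => m k - n k) = 12 := by
    unfold intForm at *
    linear_combination hm1 - hmn
  obtain ⟨w, hw, hwx⟩ := exists_mem_WE6_reflection (ha.ofIntCoords_mem_PhiE6 h5)
    (by rw [B6_ofIntCoords, ha.1]; norm_num)
  refine ⟨w, hw, ?_⟩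
  have h := ofIntCoords_sub_smul m (fun k => m k - n k) 1
  rw [hwx, B6_ofIntCoords, h12]
  simpa using h

/-- A finite box containing all weights in integral coordinates. -/
def weightBox : Finset (Fin 6 → ℤ) :=
  Fintype.piFinset fun k => if k = 5 then {4, 1, -2} else {-2, -1, 0, 1, 2}

lemma IsIntWeight.mem_weightBox {n : Fin 6 → ℤ} (hn : IsIntWeight n) : n ∈ weightBox := by
  obtain ⟨h1, -, h3⟩ := hn
  unfold intForm at h1
  have h0 : ∀ k, 0 ≤ n k * n k := fun k => mul_self_nonneg _
  have b0 := h0 0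
  have b1 := h0 1
  have b2 := h0 2
  have b3 := h0 3
  have b4 := h0 4
  have b5 := h0 5
  have hsmall : ∀ k, k ≠ 5 → n k * n k ≤ 5 := by
    intro k hk
    fin_cases k <;> simp at hk ⊢ <;> omega
  refine Fintype.mem_piFinset.mpr fun k => ?_
  by_cases hk : k = 5
  · subst hk
    have hl : -4 ≤ n 5 := by nlinarith
    have hu : n 5 ≤ 4 := by nlinarith
    simp
    omega
  · have hk5 := hsmall k hk
    have hl : -2 ≤ n k := by nlinarith
    have hu : n k ≤ 2 := by nlinarith
    simp [hk]
    omega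

lemma card_filter_weightBox : (weightBox.filter IsIntWeight).card = 27 := by
  decide +kernel

lemma setOf_isIntWeight : {n | IsIntWeight n} = (weightBox.filter IsIntWeight : Set _) := by
  ext n
  simpa using fun h : IsIntWeight n => h.mem_weightBox

lemma exists_intForm_eq_four : ∀ n ∈ weightBox.filter IsIntWeight, n 5 = -2 →
    ∃ m ∈ Fintype.piFinset fun k : Fin 6 => if k = 5 then {1} else ({1, -1} : Finset ℤ),
      m 5 = 1 ∧ IsIntWeight m ∧ intForm m n = 4 := by
  decide +kernel

lemma ofIntCoords_highest : ofIntCoords ![0, 0, 0, 0, 0, 4] = varpiE6 := by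
  funext k
  have h0 := ofReal_sqrt_three_ne_zero
  fin_cases k <;> simp [ofIntCoords, varpiE6]
  field_simp
  norm_num

lemma isIntWeight_highest : IsIntWeight ![0, 0, 0, 0, 0, 4] := by
  decide

lemma image_weights_of_mem_WE6 {w : (Fin 6 → ℂ) ≃ₗ[ℂ] (Fin 6 → ℂ)} (hw : w ∈ WE6) :
    w '' (ofIntCoords '' {n | IsIntWeight n}) = ofIntCoords '' {n | IsIntWeight n} := by
  have hfin : (ofIntCoords '' {n | IsIntWeight n}).Finite := by
    rw [setOf_isIntWeight]
    exact (Finset.finite_toSet _).image _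
  induction hw using Subgroup.closure_induction with
  | mem w hw =>
    obtain ⟨α, hα, hwx⟩ := hw
    obtain ⟨a, ha, rfl⟩ := exists_isIntRoot_of_mem_PhiE6 hα
    refine Set.eq_of_subset_of_ncard_le ?_ (Set.ncard_image_of_injective _ w.injective).ge hfin
    rintro _ ⟨_, ⟨n, hn, rfl⟩, rfl⟩
    obtain ⟨c, hc⟩ := hn.2.1.twelve_dvd_intForm ha.2.1 ha.2.2
    refine ⟨_, hn.sub_mul ha hc, ?_⟩
    rw [hwx, B6_ofIntCoords, hc, ← ofIntCoords_sub_smul]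
    push_cast
    rw [mul_div_cancel_left₀ _ (by norm_num)]
  | one => exact Set.image_id _
  | mul x y _ _ hx hy =>
    rw [show ⇑(x * y) = x ∘ y from rfl, Set.image_comp, hy, hx]
  | inv x _ hx =>
    conv_lhs => rw [← hx]
    rw [← Set.image_comp]
    have : ⇑x⁻¹ ∘ ⇑x = id := funext fun v => x.symm_apply_apply v
    rw [this, Set.image_id]

lemma IsIntWeight.exists_mem_WE6 {n : Fin 6 → ℤ} (hn : IsIntWeight n) :
    ∃ w ∈ WE6, w varpiE6 = ofIntCoords n := by
  have hone : ∀ m, IsIntWeight m → m 5 = 1 → ∃ w ∈ WE6, w varpiE6 = ofIntCoords m := by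
    intro m hm hm5
    rw [← ofIntCoords_highest]
    exact exists_mem_WE6_apply_eq isIntWeight_highest hm (by simp [intForm, hm5])
      (by simp [hm5])
  have h5 : n 5 = 4 ∨ n 5 = 1 ∨ n 5 = -2 := by
    simpa using Fintype.mem_piFinset.mp hn.mem_weightBox 5
  rcases h5 with h5 | h5 | h5
  · refine ⟨1, one_mem _, ?_⟩
    rw [← ofIntCoords_highest]
    have h1 := hn.1
    unfold intForm at h1
    have h0 : ∀ k, 0 ≤ n k * n k := fun k => mul_self_nonneg _
    have b0 := h0 0
    have b1 := h0 1
    have b2 := h0 2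
    have b3 := h0 3
    have b4 := h0 4
    rw [h5] at h1
    have hz : ∀ k, k ≠ 5 → n k = 0 := by
      intro k hk
      refine mul_self_eq_zero.mp ?_
      fin_cases k <;> simp only [Fin.reduceFinMk, Fin.zero_eta, Fin.mk_one] at hk ⊢ <;>
        omega
    have : n = ![0, 0, 0, 0, 0, 4] := by
      funext k
      fin_cases k <;> first | exact h5 | exact hz _ (by decide)
    rw [this]
    rfl
  · exact hone n hn h5
  · obtain ⟨m, -, hm5, hm, hmn⟩ := exists_intForm_eq_four n
      (Finset.mem_filter.mpr ⟨hn.mem_weightBox, hn⟩) h5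
    obtain ⟨w, hw, hwm⟩ := hone m hm hm5
    obtain ⟨v, hv, hvn⟩ := exists_mem_WE6_apply_eq hm hn hmn (by omega)
    exact ⟨v * w, mul_mem hv hw, by rw [LinearEquiv.mul_apply, hwm, hvn]⟩

lemma orbit_varpiE6_eq :
    {μ : Fin 6 → ℂ | ∃ w ∈ WE6, w varpiE6 = μ} = ofIntCoords '' {n | IsIntWeight n} := by
  ext μ
  constructor
  · rintro ⟨w, hw, rfl⟩
    rw [← image_weights_of_mem_WE6 hw, ← ofIntCoords_highest]
    exact ⟨_, ⟨_, isIntWeight_highest, rfl⟩, rfl⟩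
  · rintro ⟨n, hn, rfl⟩
    exact IsIntWeight.exists_mem_WE6 hn

/-- The Weyl orbit of the minuscule fundamental weight `ϖ₆` of `E₆` has exactly 27
elements (the weights of the 27-dimensional minuscule representation). -/
theorem orbit_varpi6_card_27 :
    Set.ncard {μ : Fin 6 → ℂ | ∃ w ∈ WE6, w varpiE6 = μ} = 27 := by
  rw [orbit_varpiE6_eq, Set.ncard_image_of_injective _ ofIntCoords_injective, setOf_isIntWeight,
    Set.ncard_coe_finset, card_filter_weightBox]
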